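/- The polynomial f(z₀,z₁,z₂,z₃,z₄) = z₀¹⁹⁵ + z₀z₁⁶ + z₁z₂³ + z₂z₃⁷ + z₃z₄² in ℂ[z₀,...,z₄] is weighted homogeneous of degree 1755 with weights (9, 291, 488, 181, 787), i.e. f(λ⁹z₀, λ²⁹¹z₁, λ⁴⁸⁸z₂, λ¹⁸¹z₃, λ⁷⁸⁷z₄) = λ¹⁷⁵⁵ f(z₀,z₁,z₂,z₃,z₄) for all λ ∈ ℂ, and it has an isolated singularity at the origin: if all five partial derivatives of f vanish at a point z ∈ ℂ⁵, then z = 0. -/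

import Mathlib

theorem deriv_mul_pow_add_mul_add (a b c x : ℂ) (n : ℕ) :
    deriv (fun t : ℂ => a * t ^ n + b * t + c) x = a * (n * x ^ (n - 1)) + b := by
  have h := ((((hasDerivAt_pow n x).const_mul a).add ((hasDerivAt_id x).const_mul b)).add_const c)
  simpa using h.deriv

/-- The polynomial `f(z) = z₀^195 + z₀z₁^6 + z₁z₂^3 + z₂z₃^7 + z₃z₄^2`
is weighted homogeneous of degree `1755` with weights `(9, 291, 488, 181, 787)`, and has an
isolated singularity at the origin: if all five partial derivatives `∂f/∂zᵢ`
vanish at a point `z ∈ ℂ⁵`, then `z = 0`. -/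
theorem orlik_poly_stmt15 :
    let w : Fin 5 → ℕ := ![9, 291, 488, 181, 787]
    let f : (Fin 5 → ℂ) → ℂ := fun z =>
      z 0 ^ 195 + z 0 * z 1 ^ 6 + z 1 * z 2 ^ 3 + z 2 * z 3 ^ 7 + z 3 * z 4 ^ 2
    (∀ (lam : ℂ) (z : Fin 5 → ℂ),
        f (fun i => lam ^ w i * z i) = lam ^ 1755 * f z) ∧
    (∀ z : Fin 5 → ℂ,
        (∀ i : Fin 5, deriv (fun t => f (Function.update z i t)) (z i) = 0) →
        z = 0) := by
  intro w f
  refine ⟨fun lam z => ?_, fun z h => ?_⟩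
  · simp only [f, w, Matrix.cons_val]
    ring
  have partial_deriv (i : Fin 5) (a b c : ℂ) (n : ℕ)
      (hf : ∀ t, f (Function.update z i t) = a * t ^ n + b * t + c) :
      a * (n * z i ^ (n - 1)) + b = 0 := by
    rw [← deriv_mul_pow_add_mul_add a b c, ← funext hf]
    exact h i
  have h0 := partial_deriv 0 1 (z 1 ^ 6)
    (z 1 * z 2 ^ 3 + z 2 * z 3 ^ 7 + z 3 * z 4 ^ 2) 195
    (fun t => by simp [f]; ring)
  have h1 := partial_deriv 1 (z 0) (z 2 ^ 3)
    (z 0 ^ 195 + z 2 * z 3 ^ 7 + z 3 * z 4 ^ 2) 6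
    (fun t => by simp [f]; ring)
  have h2 := partial_deriv 2 (z 1) (z 3 ^ 7)
    (z 0 ^ 195 + z 0 * z 1 ^ 6 + z 3 * z 4 ^ 2) 3
    (fun t => by simp [f]; ring)
  have h3 := partial_deriv 3 (z 2) (z 4 ^ 2)
    (z 0 ^ 195 + z 0 * z 1 ^ 6 + z 1 * z 2 ^ 3) 7
    (fun t => by simp [f]; ring)
  have h4 := partial_deriv 4 (z 3) 0
    (z 0 ^ 195 + z 0 * z 1 ^ 6 + z 1 * z 2 ^ 3 + z 2 * z 3 ^ 7) 2
    (fun t => by simp [f]; ring)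
  have z3 : z 3 = 0 := by
    by_contra hz3
    have z4 : z 4 = 0 := by simpa [hz3] using h4
    have z2 : z 2 = 0 := by simpa [z4, hz3] using h3
    exact hz3 (by simpa [z2] using h2)
  have z4 : z 4 = 0 := by simpa [z3] using h3
  have z2 : z 2 = 0 := by
    by_contra hz2
    have z1 : z 1 = 0 := by simpa [z3, hz2] using h2
    exact hz2 (by simpa [z1] using h1)
  have z1 : z 1 = 0 := by
    by_contra hz1
    have z0 : z 0 = 0 := by simpa [z2, hz1] using h1
    exact hz1 (by simpa [z0] using h0)
  have z0 : z 0 = 0 := by simpa [z1] using h0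
  ext i
  fin_cases i <;> assumption
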